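/- Fix positive integers r, m, n and set M = r·m, N = r·n, with S the subsampling matrix associated with the lattice embedding ι : ZMod m × ZMod n → ZMod M × ZMod N sending (1,0) to (r,0) and (0,1) to (0,r). Let c, t : ZMod M × ZMod N → ℝ, A = S * C_c, Γ = C_{t ⋆ ť}, and let η : ZMod m × ZMod n → ℝ be any coarse-grid kernel. Then Γ * Aᵀ * C'_η = C_λ * Sᵀ, where λ = t ⋆ ť ⋆ č ⋆ (Sᵀ.mulVec η) : ZMod M × ZMod N → ℝ. In particular, the kriging operator Λᵀ = Γ Aᵀ (A Γ Aᵀ)† acts on a low-resolution image v by the convolution Λᵀ v = λ ⋆ (Sᵀ v) whenever C'_η is the pseudoinverse of A Γ Aᵀ. -/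

import Mathlib

open Matrix

/-- Periodic convolution on a finite abelian group. -/
noncomputable def conv {G : Type*} [AddCommGroup G] [Fintype G] (u v : G → ℝ) : G → ℝ :=
  fun x => ∑ y, u (x - y) * v y

/-- The convolution matrix `C_u` with entries `C_u(x, y) = u (x - y)`. -/
noncomputable def convMat {G : Type*} [AddCommGroup G] [Fintype G] (u : G → ℝ) :
    Matrix G G ℝ :=
  Matrix.of fun x y => u (x - y)

/-- The subsampling matrix associated with an embedding `ι` of the coarse grid in the
fine grid: `S(x, z) = 1` if `z = ι x` and `0` otherwise. -/
noncomputable def sampMat {H G : Type*} [Fintype H] [Fintype G] [DecidableEq G]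
    (ι : H → G) : Matrix H G ℝ :=
  Matrix.of fun x z => if z = ι x then 1 else 0

theorem convMat_mul_aux {G : Type*} [AddCommGroup G] [Fintype G] (u v : G → ℝ) :
    convMat u * convMat v = convMat (conv u v) := by
  ext x z
  simp only [Matrix.mul_apply, convMat, Matrix.of_apply, conv]
  refine Fintype.sum_equiv (Equiv.subRight z) _ _ fun y => ?_
  simp only [Equiv.subRight_apply, sub_sub_sub_cancel_right]

theorem sampMat_conv_aux {H G : Type*} [AddCommGroup H] [Fintype H] [AddCommGroup G] [Fintype G]
    [DecidableEq G] (ι : H →+ G) (η : H → ℝ) :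
    (sampMat ι)ᵀ * convMat η = convMat ((sampMat ι)ᵀ.mulVec η) * (sampMat ι)ᵀ := by
  ext x h
  have h1 : (convMat ((sampMat ι)ᵀ.mulVec η) * (sampMat ι)ᵀ) x h
      = (sampMat ι)ᵀ.mulVec η (x - ι h) := by
    simp [Matrix.mul_apply, convMat, sampMat]
  rw [h1]
  simp only [Matrix.mul_apply, Matrix.mulVec, dotProduct, convMat, sampMat, Matrix.of_apply,
    Matrix.transpose_apply]
  refine Fintype.sum_equiv (Equiv.subRight h) _ _ fun y => ?_
  simp only [Equiv.subRight_apply, map_sub, sub_left_inj]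

/-- The kriging operator acts by convolution: for `A = S * C_c`, `Γ = C_{t ⋆ ť}` and any
coarse-grid kernel `η`, `Γ * Aᵀ * C'_η = C_λ * Sᵀ` with
`λ = t ⋆ ť ⋆ č ⋆ (Sᵀ η)`. -/
theorem kriging_operator_as_convolution
    (r m n : ℕ) [NeZero r] [NeZero m] [NeZero n]
    (ι : (ZMod m × ZMod n) →+ ZMod (r * m) × ZMod (r * n))
    (hinj : Function.Injective ι)
    (h10 : ι (1, 0) = ((r : ZMod (r * m)), 0))
    (h01 : ι (0, 1) = (0, (r : ZMod (r * n))))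
    (c t : ZMod (r * m) × ZMod (r * n) → ℝ)
    (η : ZMod m × ZMod n → ℝ) :
    convMat (conv t (fun x => t (-x))) * (sampMat ι * convMat c)ᵀ * convMat η
      = convMat (conv (conv (conv t (fun x => t (-x))) (fun x => c (-x)))
          ((sampMat ι)ᵀ.mulVec η)) * (sampMat ι)ᵀ := by
  have hT : (convMat c)ᵀ = convMat (fun x => c (-x)) := by
    ext x y
    simp [convMat]
  rw [Matrix.transpose_mul, hT, Matrix.mul_assoc, Matrix.mul_assoc, sampMat_conv_aux,
    ← Matrix.mul_assoc, ← Matrix.mul_assoc, convMat_mul_aux, ← convMat_mul_aux _ (Matrix.mulVec _ _)]
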